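/- arXiv:1709.08979 — 6 statements merged into one kernel-verified Lean document; each statement's English description precedes it below -/
import Mathlib

section
/- Let R be a commutative ring, f = c_1 m_1 + ... + c_t m_t ∈ R[x_1,...,x_n] with nonzero coefficients and pairwise distinct monomials, T an integer with T ≥ t, D an integer with D ≥ 2 and D > deg f, and N_1 = ⌈n(T−1) log₂ D⌉. Then for each term c_i m_i of f, the set of primes p such that c_i m_i is a collision in f^mod_{(D,p)} has at most N_1 − 1 elements. -/
open Polynomial

/-- Kronecker value of a monomial `m = x₁^{e₁}⋯xₙ^{eₙ}`:
`K(m) = e₁ + e₂ D + ⋯ + eₙ D^{n-1}`. -/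
noncomputable def kval {n : ℕ} (D : ℕ) (m : Fin n →₀ ℕ) : ℕ :=
  ∑ i, m i * D ^ (i : ℕ)

theorem kval_eq_finFunctionFinEquiv {n D : ℕ} (m : Fin n →₀ ℕ) (h : ∀ i, m i < D) :
    kval D m = finFunctionFinEquiv (fun i => (⟨m i, h i⟩ : Fin D)) := by
  simp [kval]

theorem kval_lt {n D : ℕ} (m : Fin n →₀ ℕ) (h : ∀ i, m i < D) : kval D m < D ^ n := by
  rw [kval_eq_finFunctionFinEquiv m h]
  exact Fin.isLt _

theorem kval_inj {n D : ℕ} {m m' : Fin n →₀ ℕ} (h : ∀ i, m i < D) (h' : ∀ i, m' i < D)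
    (e : kval D m = kval D m') : m = m' := by
  rw [kval_eq_finFunctionFinEquiv m h, kval_eq_finFunctionFinEquiv m' h'] at e
  have e' := finFunctionFinEquiv.injective (Fin.ext e)
  ext i
  simpa using congrFun e' i

theorem two_pow_card_primeFactors_le {a : ℕ} (ha : a ≠ 0) : 2 ^ a.primeFactors.card ≤ a :=
  (Finset.pow_card_le_prod _ _ _ fun _ hp => (Nat.prime_of_mem_primeFactors hp).two_le).trans
    (Nat.le_of_dvd (Nat.pos_of_ne_zero ha) (Nat.prod_primeFactors_dvd a))

theorem stmt1 {R : Type*} [CommRing R] {n : ℕ} (f : MvPolynomial (Fin n) R)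
    (T D N1 : ℕ) (hT : f.support.card ≤ T) (hD2 : 2 ≤ D) (hD : f.totalDegree < D)
    (hN1 : N1 = ⌈(↑(n * (T - 1)) : ℝ) * Real.logb 2 D⌉₊)
    (m : Fin n →₀ ℕ) (hm : m ∈ f.support) :
    {p : ℕ | p.Prime ∧ ∃ m' ∈ f.support, m' ≠ m ∧
        kval D m' % p = kval D m % p}.Finite ∧
    {p : ℕ | p.Prime ∧ ∃ m' ∈ f.support, m' ≠ m ∧
        kval D m' % p = kval D m % p}.ncard ≤ N1 - 1 := by
  classical
  have hlt : ∀ m' ∈ f.support, ∀ i, m' i < D := fun m' h i =>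
    ((MvPolynomial.le_degreeOf_of_mem_support i h).trans
      (MvPolynomial.degreeOf_le_totalDegree f i)).trans_lt hD
  set S := f.support.erase m with hS
  set P : ℕ := ∏ m' ∈ S, ((kval D m' : ℤ) - kval D m).natAbs with hP
  have hne : ∀ m' ∈ S, ((kval D m' : ℤ) - kval D m).natAbs ≠ 0 := by
    intro m' h h0
    obtain ⟨h1, h2⟩ := Finset.mem_erase.mp h
    exact h1 (kval_inj (hlt m' h2) (hlt m hm) (by omega))
  have hP0 : P ≠ 0 := Finset.prod_ne_zero_iff.mpr hne
  have hsub : {p : ℕ | p.Prime ∧ ∃ m' ∈ f.support, m' ≠ m ∧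
      kval D m' % p = kval D m % p} ⊆ (P.primeFactors : Set ℕ) := by
    rintro p ⟨hp, m', h1, h2, h3⟩
    refine Finset.mem_coe.mpr (Nat.mem_primeFactors.mpr ⟨hp, ?_, hP0⟩)
    refine dvd_trans ?_ (Finset.dvd_prod_of_mem _ (Finset.mem_erase.mpr ⟨h2, h1⟩))
    exact Int.natCast_dvd.mp (Nat.modEq_iff_dvd.mp (Eq.symm h3))
  refine ⟨P.primeFactors.finite_toSet.subset hsub, ?_⟩
  have hcard := Set.ncard_le_ncard hsub P.primeFactors.finite_toSet
  rw [Set.ncard_coe_finset] at hcard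
  refine hcard.trans ?_
  rcases S.eq_empty_or_nonempty with hE | hE
  · simp [hP, hE]
  have hPlt : P < D ^ (n * (T - 1)) := by
    calc P < ∏ _m' ∈ S, D ^ n := by
          refine Finset.prod_lt_prod_of_nonempty
            (fun m' h => Nat.pos_of_ne_zero (hne m' h)) (fun m' h => ?_) hE
          have h1 := kval_lt m' (hlt m' (Finset.mem_of_mem_erase h))
          have h2 := kval_lt m (hlt m hm)
          omega
      _ = D ^ (n * S.card) := by rw [Finset.prod_const, pow_mul]
      _ ≤ D ^ (n * (T - 1)) := by
          refine Nat.pow_le_pow_right (by omega) (Nat.mul_le_mul_left n ?_)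
          rw [hS, Finset.card_erase_of_mem hm]
          omega
  have hpow : 2 ^ P.primeFactors.card < D ^ (n * (T - 1)) :=
    (two_pow_card_primeFactors_le hP0).trans_lt hPlt
  have hlog : (P.primeFactors.card : ℝ) < (↑(n * (T - 1)) : ℝ) * Real.logb 2 D := by
    rw [← Real.logb_pow, Real.lt_logb_iff_rpow_lt (by norm_num)
      (by positivity), Real.rpow_natCast]
    exact_mod_cast hpow
  have := Nat.lt_ceil.mpr hlog
  omega
end

section
/- Let R be a commutative ring, f ∈ R[x] a univariate polynomial, D an integer with D > deg f, and p, q positive integers. If #f^mod_{(D,p)} ≥ #f^mod_{(D,q)}, then C^f_{(D,p)} ≤ 2 · C^f_{(D,q)}. -/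
open Polynomial

/-- `f^mod_{(D,p)} = f(x) mod (x^p - 1)` for a univariate polynomial `f`. -/
noncomputable def umod {R : Type*} [CommRing R] (p : ℕ) (f : Polynomial R) :
    Polynomial R :=
  ∑ e ∈ f.support, Polynomial.monomial (e % p) (f.coeff e)

/-- `C^f_{(D,p)}`: the number of terms of `f` that are collisions in
`f^mod_{(D,p)}`, i.e. whose exponent is congruent modulo `p` to the exponent
of another term of `f`. -/
noncomputable def ucoll {R : Type*} [CommRing R] (p : ℕ) (f : Polynomial R) : ℕ :=
  (f.support.filter fun e => ∃ e' ∈ f.support, e' ≠ e ∧ e' % p = e % p).card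

open Finset in
theorem two_mul_card_image_le_of_exists_ne {α β : Type*} [DecidableEq β] (s : Finset α)
    (g : α → β) (h : ∀ a ∈ s, ∃ b ∈ s, b ≠ a ∧ g b = g a) :
    2 * (s.image g).card ≤ s.card := by
  rw [card_eq_sum_card_image g s, mul_comm, ← smul_eq_mul]
  refine card_nsmul_le_sum _ _ _ fun y hy => ?_
  obtain ⟨a, ha, rfl⟩ := mem_image.mp hy
  obtain ⟨b, hb, hne, hg⟩ := h a ha
  exact one_lt_card.mpr ⟨b, by simp [hb, hg], a, by simp [ha], hne⟩

theorem coeff_umod {R : Type*} [CommRing R] (p : ℕ) (f : Polynomial R) (n : ℕ) :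
    (umod p f).coeff n = ∑ e ∈ f.support, if e % p = n then f.coeff e else 0 := by
  simp [umod, Polynomial.coeff_monomial]

theorem card_support_le_card_support_umod_add_ucoll {R : Type*} [CommRing R] (p : ℕ)
    (f : Polynomial R) : f.support.card ≤ (umod p f).support.card + ucoll p f := by
  classical
  rw [ucoll, ← Finset.card_filter_add_card_filter_not
    (s := f.support) (fun e => ∃ e' ∈ f.support, e' ≠ e ∧ e' % p = e % p), add_comm]
  refine Nat.add_le_add_right (Finset.card_le_card_of_injOn (· % p) ?_ ?_) _
  · intro e he
    obtain ⟨he, hc⟩ := Finset.mem_filter.mp he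
    rw [Finset.mem_coe, mem_support_iff, coeff_umod, Finset.sum_eq_single_of_mem e he]
    · simpa using mem_support_iff.mp he
    · exact fun b hb hne => if_neg fun hbe => hc ⟨b, hb, hne, hbe⟩
  · intro a ha b hb hab
    by_contra hne
    exact (Finset.mem_filter.mp ha).2
      ⟨b, (Finset.mem_filter.mp hb).1, Ne.symm hne, Eq.symm hab⟩

theorem support_umod_subset {R : Type*} [CommRing R] (p : ℕ) (f : Polynomial R) :
    (umod p f).support ⊆ f.support.image (· % p) := by
  intro n hn
  rw [mem_support_iff, coeff_umod] at hn
  obtain ⟨e, he, hne⟩ := Finset.exists_ne_zero_of_sum_ne_zero hn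
  exact Finset.mem_image.mpr ⟨e, he, (ite_ne_right_iff.mp hne).1⟩

theorem two_mul_card_support_umod_add_ucoll_le {R : Type*} [CommRing R] (p : ℕ)
    (f : Polynomial R) : 2 * (umod p f).support.card + ucoll p f ≤ 2 * f.support.card := by
  classical
  have hsub := Finset.card_le_card (support_umod_subset p f)
  have hcard := Finset.card_filter_add_card_filter_not
    (s := f.support) (fun e => ∃ e' ∈ f.support, e' ≠ e ∧ e' % p = e % p)
  have hcoll := two_mul_card_image_le_of_exists_ne
    (f.support.filter fun e => ∃ e' ∈ f.support, e' ≠ e ∧ e' % p = e % p) (· % p) (by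
      intro a ha
      obtain ⟨ha, b, hb, hne, hba⟩ := Finset.mem_filter.mp ha
      exact ⟨b, Finset.mem_filter.mpr ⟨hb, a, ha, hne.symm, hba.symm⟩, hne, hba⟩)
  rw [← Finset.filter_union_filter_not_eq
    (fun e => ∃ e' ∈ f.support, e' ≠ e ∧ e' % p = e % p) f.support,
    Finset.image_union] at hsub
  have hunion := hsub.trans (Finset.card_union_le _ _)
  have hfree := Finset.card_image_le (f := (· % p))
    (s := f.support.filter fun e => ¬ ∃ e' ∈ f.support, e' ≠ e ∧ e' % p = e % p)
  rw [ucoll]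
  omega

theorem stmt5 {R : Type*} [CommRing R] (f : Polynomial R) (D p q : ℕ)
    (hD : f.natDegree < D) (hp : 0 < p) (hq : 0 < q)
    (h : (umod q f).support.card ≤ (umod p f).support.card) :
    ucoll p f ≤ 2 * ucoll q f := by
  have hle := card_support_le_card_support_umod_add_ucoll q f
  have hge := two_mul_card_support_umod_add_ucoll_le p f
  omega
end

section
/- Let R be a commutative ring, f ∈ R[x_1,...,x_n], D an integer with D ≥ 2 and D > deg f, and p, q positive integers. If #f^mod_{(D,p)} ≥ #f^mod_{(D,q)}, then C^f_{(D,p)} ≤ 2 · C^f_{(D,q)}. -/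
open Polynomial

/-- `f^mod_{(D,p)} = f(x, x^D, …, x^{D^{n-1}}) mod (x^p - 1)`. -/
noncomputable def fmod {R : Type*} [CommRing R] {n : ℕ} (D p : ℕ)
    (f : MvPolynomial (Fin n) R) : Polynomial R :=
  ∑ m ∈ f.support, Polynomial.monomial (kval D m % p) (MvPolynomial.coeff m f)

/-- `C^f_{(D,p)}`: the number of terms of `f` that are collisions in
`f^mod_{(D,p)}`. -/
noncomputable def mcoll {R : Type*} [CommRing R] {n : ℕ} (D p : ℕ)
    (f : MvPolynomial (Fin n) R) : ℕ :=
  (f.support.filter fun m =>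
    ∃ m' ∈ f.support, m' ≠ m ∧ kval D m' % p = kval D m % p).card

theorem coeff_sum_monomial {R α : Type*} [Semiring R] (s : Finset α) (g : α → ℕ) (c : α → R)
    (k : ℕ) :
    (∑ m ∈ s, monomial (g m) (c m)).coeff k = ∑ m ∈ s, if g m = k then c m else 0 := by
  simp [coeff_monomial]

/-- Terms that share their exponent with no other term survive in the sum. -/
theorem card_le_card_support_add_card_collisions {R α : Type*} [Semiring R] (s : Finset α)
    (g : α → ℕ) (c : α → R) (hc : ∀ m ∈ s, c m ≠ 0)
    [DecidablePred fun m => ∃ m' ∈ s, m' ≠ m ∧ g m' = g m] :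
    s.card ≤ (∑ m ∈ s, monomial (g m) (c m)).support.card +
      (s.filter fun m => ∃ m' ∈ s, m' ≠ m ∧ g m' = g m).card := by
  classical
  have hsplit := Finset.card_filter_add_card_filter_not (s := s)
    (fun m => ∃ m' ∈ s, m' ≠ m ∧ g m' = g m)
  have hle : (s.filter fun m => ¬ ∃ m' ∈ s, m' ≠ m ∧ g m' = g m).card ≤
      (∑ m ∈ s, monomial (g m) (c m)).support.card := by
    apply Finset.card_le_card_of_injOn g
    · intro m hm
      simp only [Finset.coe_filter, Set.mem_ofPred_eq] at hm
      obtain ⟨hms, hm⟩ := hm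
      rw [Finset.mem_coe, mem_support_iff, coeff_sum_monomial, Finset.sum_eq_single m]
      · simpa using hc m hms
      · intro b hb hbm
        exact if_neg fun hgb => hm ⟨b, hb, hbm, hgb⟩
      · exact fun hns => absurd hms hns
    · intro a ha b hb hab
      simp only [Finset.coe_filter, Set.mem_ofPred_eq] at ha hb
      by_contra hne
      exact hb.2 ⟨a, ha.1, hne, hab⟩
  omega

/-- Colliding terms contribute at most one exponent for every two of them. -/
theorem two_mul_card_support_add_card_collisions_le {R α : Type*} [Semiring R] (s : Finset α)
    (g : α → ℕ) (c : α → R)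
    [DecidablePred fun m => ∃ m' ∈ s, m' ≠ m ∧ g m' = g m] :
    2 * (∑ m ∈ s, monomial (g m) (c m)).support.card +
      (s.filter fun m => ∃ m' ∈ s, m' ≠ m ∧ g m' = g m).card ≤ 2 * s.card := by
  classical
  have hsplit := Finset.card_filter_add_card_filter_not (s := s)
    (fun m => ∃ m' ∈ s, m' ≠ m ∧ g m' = g m)
  set F := s.filter fun m => ∃ m' ∈ s, m' ≠ m ∧ g m' = g m with hF
  set N := s.filter fun m => ¬ ∃ m' ∈ s, m' ≠ m ∧ g m' = g m with hN
  have hsub : (∑ m ∈ s, monomial (g m) (c m)).support ⊆ N.image g ∪ F.image g := by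
    intro k hk
    rw [mem_support_iff, coeff_sum_monomial] at hk
    obtain ⟨m, hm, hne⟩ := Finset.exists_ne_zero_of_sum_ne_zero hk
    have hgm : g m = k := by
      by_contra hgm
      exact hne (if_neg hgm)
    rw [← Finset.image_union, Finset.union_comm, Finset.filter_union_filter_not_eq]
    exact Finset.mem_image.2 ⟨m, hm, hgm⟩
  have hcard := (Finset.card_le_card hsub).trans (Finset.card_union_le _ _)
  have hNimg : (N.image g).card ≤ N.card := Finset.card_image_le
  have hFimg : 2 * (F.image g).card ≤ F.card := by
    refine Finset.mul_card_image_le_card F 2 fun k hk => ?_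
    obtain ⟨m, hm, rfl⟩ := Finset.mem_image.1 hk
    obtain ⟨hms, m', hms', hne, hg⟩ := Finset.mem_filter.1 hm
    refine Finset.one_lt_card.2 ⟨m, by simp [hm], m', ?_, hne.symm⟩
    exact Finset.mem_filter.2 ⟨Finset.mem_filter.2 ⟨hms', m, hms, hne.symm, hg.symm⟩, hg⟩
  omega

theorem stmt6 {R : Type*} [CommRing R] {n : ℕ} (f : MvPolynomial (Fin n) R)
    (D p q : ℕ) (hD2 : 2 ≤ D) (hD : f.totalDegree < D) (hp : 0 < p) (hq : 0 < q)
    (h : (fmod D q f).support.card ≤ (fmod D p f).support.card) :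
    mcoll D p f ≤ 2 * mcoll D q f := by
  classical
  have hq' := card_le_card_support_add_card_collisions f.support (fun m => kval D m % q)
    (fun m => MvPolynomial.coeff m f) (fun _ hm => MvPolynomial.mem_support_iff.1 hm)
  have hp' := two_mul_card_support_add_card_collisions_le f.support (fun m => kval D m % p)
    (fun m => MvPolynomial.coeff m f)
  unfold fmod at h
  have hmp : mcoll D p f = (f.support.filter fun m =>
    ∃ m' ∈ f.support, m' ≠ m ∧ kval D m' % p = kval D m % p).card := by
    unfold mcoll; congr
  have hmq : mcoll D q f = (f.support.filter fun m =>
    ∃ m' ∈ f.support, m' ≠ m ∧ kval D m' % q = kval D m % q).card := by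
    unfold mcoll; congr
  rw [hmp, hmq]
  omega
end

section
/- Let R be a commutative ring, f = c_1 m_1 + ... + c_t m_t ∈ R[x_1,...,x_n] with nonzero coefficients and pairwise distinct monomials m_i = x_1^{e_{i,1}}···x_n^{e_{i,n}}, D an integer with D ≥ 2 and D > deg f, and let A = ∏_{1 ≤ i < j ≤ t} (K(m_i) − K(m_j)) ∈ ℤ. If p is a prime and C^f_{(D,p)} = s, then p^{⌈s/2⌉} divides A. -/
open Polynomial

theorem card_collisions_le_two_mul_card_pairs {ι α : Type*} [Fintype ι] [LinearOrder ι]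
    [LocallyFiniteOrderTop ι] [DecidableEq α] (k : ι → α)
    [DecidablePred fun i => ∃ j, j ≠ i ∧ k j = k i] :
    (Finset.univ.filter fun i => ∃ j, j ≠ i ∧ k j = k i).card ≤
      2 * ((Finset.univ.sigma fun i : ι => Finset.Ioi i).filter fun x => k x.1 = k x.2).card := by
  set P := (Finset.univ.sigma fun i : ι => Finset.Ioi i).filter fun x => k x.1 = k x.2
  have hsub : (Finset.univ.filter fun i => ∃ j, j ≠ i ∧ k j = k i) ⊆
      P.image (fun x => x.1) ∪ P.image (fun x => x.2) := by
    intro i hi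
    obtain ⟨j, hji, hk⟩ := (Finset.mem_filter.1 hi).2
    rcases lt_or_gt_of_ne hji with h | h
    · exact Finset.mem_union_right _ (Finset.mem_image.2 ⟨⟨j, i⟩, by simp [P, h, hk], rfl⟩)
    · exact Finset.mem_union_left _ (Finset.mem_image.2 ⟨⟨i, j⟩, by simp [P, h, hk], rfl⟩)
  calc _ ≤ (P.image (fun x => x.1) ∪ P.image (fun x => x.2)).card := Finset.card_le_card hsub
    _ ≤ (P.image (fun x => x.1)).card + (P.image (fun x => x.2)).card := Finset.card_union_le _ _
    _ ≤ P.card + P.card := add_le_add Finset.card_image_le Finset.card_image_le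
    _ = 2 * P.card := (two_mul _).symm

theorem pow_card_filter_dvd_prod {ι M : Type*} [CommMonoid M] (s : Finset ι) (g : ι → M) (p : M)
    (q : ι → Prop) [DecidablePred q] (h : ∀ x, q x → p ∣ g x) :
    p ^ (s.filter q).card ∣ ∏ x ∈ s, g x := by
  rw [← Finset.prod_const]
  exact (Finset.prod_dvd_prod_of_dvd _ _ fun x hx => h x (Finset.mem_filter.1 hx).2).trans
    (Finset.prod_dvd_prod_of_subset _ _ _ (Finset.filter_subset _ _))

theorem stmt7 {R : Type*} [CommRing R] {n t : ℕ}
    (c : Fin t → R) (e : Fin t → (Fin n →₀ ℕ))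
    (hc : ∀ i, c i ≠ 0) (he : Function.Injective e)
    (f : MvPolynomial (Fin n) R)
    (hf : f = ∑ i, MvPolynomial.monomial (e i) (c i))
    (D : ℕ) (hD2 : 2 ≤ D) (hD : f.totalDegree < D)
    (p s : ℕ) (hp : p.Prime)
    (hs : s = (Finset.univ.filter fun i : Fin t =>
      ∃ j, j ≠ i ∧ kval D (e j) % p = kval D (e i) % p).card) :
    (p : ℤ) ^ ((s + 1) / 2) ∣
      ∏ i : Fin t, ∏ j ∈ Finset.Ioi i,
        ((kval D (e i) : ℤ) - (kval D (e j) : ℤ)) := by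
  rw [← Finset.prod_sigma (Finset.univ : Finset (Fin t)) (fun i => Finset.Ioi i)
    (fun x => (kval D (e x.1) : ℤ) - (kval D (e x.2) : ℤ))]
  have hcard := card_collisions_le_two_mul_card_pairs fun i => kval D (e i) % p
  rw [← hs] at hcard
  exact (pow_dvd_pow _ (by omega)).trans
    (pow_card_filter_dvd_prod _ _ _ (fun x => kval D (e x.1) % p = kval D (e x.2) % p)
      fun x hx => Nat.modEq_iff_dvd.1 (Eq.symm hx))
end

section
/- Let R be a commutative ring, f = c_1 m_1 + ... + c_t m_t ∈ R[x_1,...,x_n] with nonzero coefficients and pairwise distinct monomials m_i = x_1^{e_{i,1}}···x_n^{e_{i,n}}, D an integer with D ≥ 2 and D > deg f, p a positive integer, and k ∈ {1,...,n}. Suppose the term c_i m_i is not a collision in f^mod_{(D,p)}, i.e. K(m_j) ≢ K(m_i) (mod p) for all j ≠ i. Let u_i = ∑_{l=1}^n e_{i,l} · (D^{l−1} mod p). Then the coefficient of x^{u_i} in f_{(D,p)} equals c_i, and the coefficient of x^{u_i + p·e_{i,k}} in f_{(D,p,k)} equals c_i. -/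
open Polynomial

/-- `f_{(D,p)}`: substitute `x_l ↦ x^{D^{l-1} mod p}` in `f`. -/
noncomputable def fsub {R : Type*} [CommRing R] {n : ℕ} (D p : ℕ)
    (f : MvPolynomial (Fin n) R) : Polynomial R :=
  ∑ m ∈ f.support,
    Polynomial.monomial (∑ l, m l * (D ^ (l : ℕ) % p)) (MvPolynomial.coeff m f)

/-- `f_{(D,p,k)}`: substitute `x_l ↦ x^{D^{l-1} mod p}` for `l ≠ k` and
`x_k ↦ x^{(D^{k-1} mod p) + p}` in `f`. -/
noncomputable def fsubk {R : Type*} [CommRing R] {n : ℕ} (D p : ℕ) (k : Fin n)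
    (f : MvPolynomial (Fin n) R) : Polynomial R :=
  ∑ m ∈ f.support,
    Polynomial.monomial
      (∑ l, m l * (if l = k then D ^ (l : ℕ) % p + p else D ^ (l : ℕ) % p))
      (MvPolynomial.coeff m f)

theorem Polynomial.coeff_sum_monomial_of_unique {R ι : Type*} [Semiring R] (s : Finset ι)
    (g : ι → ℕ) (a : ι → R) (i : ι) (hi : i ∉ s → a i = 0)
    (h : ∀ j ∈ s, j ≠ i → g j ≠ g i) :
    (∑ j ∈ s, Polynomial.monomial (g j) (a j)).coeff (g i) = a i := by
  rw [Polynomial.finsetSum_coeff, Finset.sum_eq_single i]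
  · simp
  · intro j hj hji
    exact Polynomial.coeff_monomial_of_ne _ (h j hj hji).symm
  · intro his
    simp [hi his]

theorem sum_mul_mod_modEq_kval {n : ℕ} (D p : ℕ) (m : Fin n →₀ ℕ) :
    ∑ l, m l * (D ^ (l : ℕ) % p) ≡ kval D m [MOD p] := by
  unfold kval
  rw [← ZMod.natCast_eq_natCast_iff]
  simp

theorem sum_mul_ite_mod_add {n : ℕ} (D p : ℕ) (k : Fin n) (m : Fin n →₀ ℕ) :
    ∑ l, m l * (if l = k then D ^ (l : ℕ) % p + p else D ^ (l : ℕ) % p) =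
      ∑ l, m l * (D ^ (l : ℕ) % p) + p * m k := by
  have h : ∀ l, m l * (if l = k then D ^ (l : ℕ) % p + p else D ^ (l : ℕ) % p) =
      m l * (D ^ (l : ℕ) % p) + if l = k then p * m l else 0 := by
    intro l
    split_ifs <;> ring
  simp [h, Finset.sum_add_distrib]

theorem stmt13 {R : Type*} [CommRing R] {n t : ℕ}
    (c : Fin t → R) (e : Fin t → (Fin n →₀ ℕ))
    (hc : ∀ i, c i ≠ 0) (he : Function.Injective e)
    (f : MvPolynomial (Fin n) R)
    (hf : f = ∑ i, MvPolynomial.monomial (e i) (c i))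
    (D p : ℕ) (hD2 : 2 ≤ D) (hD : f.totalDegree < D) (hp : 0 < p)
    (k : Fin n) (i : Fin t)
    (hnc : ∀ j, j ≠ i → kval D (e j) % p ≠ kval D (e i) % p)
    (u : ℕ) (hu : u = ∑ l, (e i) l * (D ^ (l : ℕ) % p)) :
    (fsub D p f).coeff u = c i ∧
    (fsubk D p k f).coeff (u + p * (e i) k) = c i := by
  have hcoeff (m : Fin n →₀ ℕ) : f.coeff m = ∑ j, if e j = m then c j else 0 := by
    simp [hf, MvPolynomial.coeff_sum, MvPolynomial.coeff_monomial]
  have hci : f.coeff (e i) = c i := by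
    simp [hcoeff, he.eq_iff]
  have hmem (m : Fin n →₀ ℕ) (hm : m ∈ f.support) : ∃ j, e j = m := by
    by_contra! hne
    exact MvPolynomial.mem_support_iff.mp hm (by simp [hcoeff, hne])
  have hmod (m : Fin n →₀ ℕ) (hm : m ∈ f.support) (hmi : m ≠ e i) :
      ¬ kval D m ≡ kval D (e i) [MOD p] := by
    obtain ⟨j, rfl⟩ := hmem m hm
    exact hnc j fun hji => hmi (congrArg e hji)
  have hsupp : e i ∉ f.support → f.coeff (e i) = 0 := MvPolynomial.notMem_support_iff.mp
  subst hu
  constructor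
  · rw [← hci]
    refine Polynomial.coeff_sum_monomial_of_unique f.support
      (fun m => ∑ l, m l * (D ^ (l : ℕ) % p)) f.coeff (e i) hsupp fun m hm hmi heq => ?_
    exact hmod m hm hmi ((sum_mul_mod_modEq_kval D p m).symm.trans
      ((congrArg (· % p) heq).trans (sum_mul_mod_modEq_kval D p (e i))))
  · rw [← hci]
    simp only [fsubk, sum_mul_ite_mod_add]
    refine Polynomial.coeff_sum_monomial_of_unique f.support
      (fun m => ∑ l, m l * (D ^ (l : ℕ) % p) + p * m k) (fun m => f.coeff m) (e i) hsupp
      fun m hm hmi heq => ?_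
    have heq' : ∑ l, m l * (D ^ (l : ℕ) % p) ≡ ∑ l, e i l * (D ^ (l : ℕ) % p) [MOD p] := by
      simpa [Nat.ModEq] using congrArg (· % p) heq
    exact hmod m hm hmi ((sum_mul_mod_modEq_kval D p m).symm.trans
      (heq'.trans (sum_mul_mod_modEq_kval D p (e i))))
end

section
/- Let R be a commutative ring, f ∈ R[x_1,...,x_n], D an integer with D ≥ 2 and D > deg f, and p a positive integer. Suppose cm is a term of f (c ≠ 0, m its monomial) that is not a collision in f^mod_{(D,p)}, i.e. no other term of f has Kronecker value congruent to K(m) modulo p. Then the coefficient of x^{K(m) mod p} in f^mod_{(D,p)} equals c, and #(f − cm)^mod_{(D,p)} = #f^mod_{(D,p)} − 1. -/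
open Polynomial

theorem fmod_eq_sum_of_support_subset {R : Type*} [CommRing R] {n : ℕ} (D p : ℕ)
    (f : MvPolynomial (Fin n) R) {s : Finset (Fin n →₀ ℕ)} (hs : f.support ⊆ s) :
    fmod D p f = ∑ m ∈ s, Polynomial.monomial (kval D m % p) (MvPolynomial.coeff m f) := by
  refine Finset.sum_subset hs fun m _ hm => ?_
  rw [MvPolynomial.notMem_support_iff.mp hm, map_zero]

theorem fmod_sub_monomial {R : Type*} [CommRing R] {n : ℕ} (D p : ℕ)
    (f : MvPolynomial (Fin n) R) {m : Fin n →₀ ℕ} (hm : m ∈ f.support) (c : R) :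
    fmod D p (f - MvPolynomial.monomial m c) =
      fmod D p f - Polynomial.monomial (kval D m % p) c := by
  classical
  have hs : (f - MvPolynomial.monomial m c).support ⊆ f.support := by
    intro a ha
    by_cases h : m = a
    · exact h ▸ hm
    · simpa [MvPolynomial.mem_support_iff, MvPolynomial.coeff_monomial, h] using ha
  rw [fmod_eq_sum_of_support_subset D p _ hs, fmod]
  simp only [MvPolynomial.coeff_sub, MvPolynomial.coeff_monomial, map_sub,
    Finset.sum_sub_distrib]
  congr 1
  rw [Finset.sum_eq_single_of_mem m hm fun a _ ha => by rw [if_neg ha.symm, map_zero],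
    if_pos rfl]

theorem stmt14 {R : Type*} [CommRing R] {n : ℕ} (f : MvPolynomial (Fin n) R)
    (D p : ℕ) (hD2 : 2 ≤ D) (hD : f.totalDegree < D) (hp : 0 < p)
    (c : R) (hc : c ≠ 0) (m : Fin n →₀ ℕ)
    (hm : m ∈ f.support) (hcoeff : MvPolynomial.coeff m f = c)
    (hnc : ∀ m' ∈ f.support, m' ≠ m → kval D m' % p ≠ kval D m % p) :
    (fmod D p f).coeff (kval D m % p) = c ∧
    (fmod D p (f - MvPolynomial.monomial m c)).support.card =
      (fmod D p f).support.card - 1 := by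
  have hk : (fmod D p f).coeff (kval D m % p) = c := by
    rw [fmod, Polynomial.finsetSum_coeff, Finset.sum_eq_single_of_mem m hm fun a ha hne =>
      Polynomial.coeff_monomial_of_ne _ (hnc a ha hne).symm, Polynomial.coeff_monomial_same, hcoeff]
  refine ⟨hk, ?_⟩
  have herase : fmod D p (f - MvPolynomial.monomial m c) =
      (fmod D p f).erase (kval D m % p) := by
    rw [fmod_sub_monomial D p f hm, sub_eq_iff_eq_add', ← hk, Polynomial.monomial_add_erase]
  rw [herase, Polynomial.support_erase, Finset.card_erase_of_mem]
  rwa [Polynomial.mem_support_iff, hk]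
end
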